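/- arXiv:cs/0301026 — 2 statements merged into one kernel-verified Lean document; each statement's English description precedes it below -/
import Mathlib

section
/- If the formula A is a substitution instance of the formula C, then the result of applying condensed detachment to the major premiss i(A,B) and the minor premiss C is B or an alphabetic variant of B. -/
/-- Propositional formulas built from countably many variables by implication `i`
and negation `n`. -/
inductive Fm : Type
  | var : ℕ → Fm
  | i : Fm → Fm → Fm
  | n : Fm → Fm
  deriving DecidableEq

namespace Fm

/-- Homomorphic extension of a substitution (of formulas for variables). -/
def subst (σ : ℕ → Fm) : Fm → Fm
  | var k => σ k
  | i a b => i (subst σ a) (subst σ b)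
  | n a => n (subst σ a)

/-- The (finite) set of variables occurring in a formula. -/
def vars : Fm → Finset ℕ
  | var k => {k}
  | i a b => vars a ∪ vars b
  | n a => vars a

/-- `Sub s t` : `s` is a (not necessarily proper) subformula of `t`. -/
inductive Sub : Fm → Fm → Prop
  | refl (t : Fm) : Sub t t
  | il {s a b : Fm} : Sub s a → Sub s (i a b)
  | ir {s a b : Fm} : Sub s b → Sub s (i a b)
  | neg {s a : Fm} : Sub s a → Sub s (n a)

end Fm

/-- The renaming substitution induced by a permutation of the variables. -/
def renameSubst (p : Equiv.Perm ℕ) : ℕ → Fm := fun k => Fm.var (p k)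

/-- `AlphVar A B` : `B` is an alphabetic variant of `A`
(obtained from `A` by an injective renaming of variables). -/
def AlphVar (A B : Fm) : Prop := ∃ p : Equiv.Perm ℕ, B = A.subst (renameSubst p)

/-- `σ` unifies `A` and `C`. -/
def Unifies (σ : ℕ → Fm) (A C : Fm) : Prop := A.subst σ = C.subst σ

/-- `σ` is a most general unifier of `A` and `C`. -/
def IsMGU (σ : ℕ → Fm) (A C : Fm) : Prop :=
  Unifies σ A C ∧ ∀ τ : ℕ → Fm, Unifies τ A C → ∃ ρ : ℕ → Fm, ∀ k, τ k = (σ k).subst ρ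

/-- Condensed detachment: from the major premiss `maj = i(A,B)` and minor premiss
`minor` (renamed to `C`, sharing no variables with the major premiss), if `σ` is a
most general unifier of `A` and `C`, conclude `Bσ` (up to renaming of variables). -/
def CD (maj minor concl : Fm) : Prop :=
  ∃ (A B C : Fm) (σ : ℕ → Fm),
    maj = Fm.i A B ∧ AlphVar minor C ∧ Disjoint (Fm.i A B).vars C.vars ∧
    IsMGU σ A C ∧ AlphVar (B.subst σ) concl

/-- A formula contains a double negation if it has a subformula of the form `n(n(t))`. -/
def ContainsDN (A : Fm) : Prop := ∃ t : Fm, Fm.Sub (Fm.n (Fm.n t)) A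

/-- Existence of a condensed-detachment proof from axiom set `L` in which every
*deduced* (non-axiom) step satisfies the predicate `allowed`.  A step is an
alphabetic variant of an axiom of `L` or follows from two earlier steps by
condensed detachment. -/
inductive CDProof (L : Set Fm) (allowed : Fm → Prop) : Fm → Prop
  | ax {a b : Fm} : a ∈ L → AlphVar a b → CDProof L allowed b
  | cd {p q c : Fm} : CDProof L allowed p → CDProof L allowed q → CD p q c → allowed c →
      CDProof L allowed c

/-- `B` is provable from `L` by condensed detachment. -/
def CDProvable (L : Set Fm) (B : Fm) : Prop := CDProof L (fun _ => True) B

/-- A formula is double-negation free. -/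
def DNFree (f : Fm) : Prop := ¬ ContainsDN f

/-- `B` has a double-negation-free condensed-detachment proof from `L`
(no deduced step contains a double negation). -/
def DNFreeCDProvable (L : Set Fm) (B : Fm) : Prop := CDProof L DNFree B

/-- Every doubly negated subformula of `f` is (an alphabetic variant of) a doubly
negated subformula of `B`. -/
def DNOk (B : Fm) : Fm → Prop := fun f =>
  ∀ t : Fm, Fm.Sub (Fm.n (Fm.n t)) f → ∃ s : Fm, Fm.Sub (Fm.n (Fm.n s)) B ∧ AlphVar s t

/-- Existence of a proof from axioms `L` and (variable-free) assumptions `Δ` using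
modus ponens and substitution, in which every deduced step satisfies `allowed`. -/
inductive HProof (L Δ : Set Fm) (allowed : Fm → Prop) : Fm → Prop
  | ax {a : Fm} : a ∈ L → HProof L Δ allowed a
  | hyp {a : Fm} : a ∈ Δ → HProof L Δ allowed a
  | mp {a b : Fm} : HProof L Δ allowed (Fm.i a b) → HProof L Δ allowed a → allowed b →
      HProof L Δ allowed b
  | subst {a : Fm} (σ : ℕ → Fm) : HProof L Δ allowed a → allowed (a.subst σ) →
      HProof L Δ allowed (a.subst σ)

/-- Existence of a proof by modus ponens only from the set `S` of premisses, in which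
every deduced step satisfies `allowed`. -/
inductive MPProof (S : Set Fm) (allowed : Fm → Prop) : Fm → Prop
  | prem {a : Fm} : a ∈ S → MPProof S allowed a
  | mp {a b : Fm} : MPProof S allowed (Fm.i a b) → MPProof S allowed a → allowed b →
      MPProof S allowed b

/-- The set of substitution instances of members of `L`. -/
def SubstInstances (L : Set Fm) : Set Fm := {b | ∃ a ∈ L, ∃ σ : ℕ → Fm, b = a.subst σ}

/-- A formula containing no variables. -/
def VarFree (A : Fm) : Prop := A.vars = ∅

/-- Replace all occurrences of the selected doubly negated subformulas `n(n(q))`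
(`q ∈ S`) by `q`. -/
def eraseDN (S : Finset Fm) : Fm → Fm
  | .var k => .var k
  | .i a b => .i (eraseDN S a) (eraseDN S b)
  | .n (.var k) => .n (.var k)
  | .n (.i a b) => .n (.i (eraseDN S a) (eraseDN S b))
  | .n (.n q) => if q ∈ S then eraseDN S q else .n (eraseDN S (.n q))

/-- `L` admits strong double-negation elimination: whenever `B` is provable from `L`
by condensed detachment and `B*` is obtained from `B` by erasing all occurrences of
a chosen set of doubly negated subformulas of `B`, then `B*` has a condensed-detachment
proof from `L` whose deduced steps contain no doubly negated subformulas other than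
(alphabetic variants of) those occurring in `B*`. -/
def StrongDNE (L : Set Fm) : Prop :=
  ∀ (B : Fm) (S : Finset Fm), CDProvable L B → (∀ q ∈ S, Fm.Sub (.n (.n q)) B) →
    CDProof L (DNOk (eraseDN S B)) (eraseDN S B)

/-- Replace every occurrence of the variable `v` by `n(v)` and cancel the resulting
double negations. -/
def flipNeg (v : ℕ) : Fm → Fm
  | .var k => if k = v then .n (.var v) else .var k
  | .i a b => .i (flipNeg v a) (flipNeg v b)
  | .n a => if a = .var v then .var v else .n (flipNeg v a)

/-- Membership in `L*`: the closure of `L` under the operation of replacing a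
negated variable `x` (i.e. one with `n(x)` occurring) everywhere by `n(x)`,
cancelling resulting double negations. -/
inductive StarMem (L : Set Fm) : Fm → Prop
  | base {a : Fm} : a ∈ L → StarMem L a
  | step {a : Fm} {v : ℕ} : StarMem L a → Fm.Sub (.n (.var v)) a → StarMem L (flipNeg v a)

/-- D1 = i(x,x) -/
def D1 : Fm := .i (.var 0) (.var 0)
/-- D2 = i(i(x,x),i(n(x),n(x))) -/
def D2 : Fm := .i (.i (.var 0) (.var 0)) (.i (.n (.var 0)) (.n (.var 0)))
/-- D3 = i(i(x,x),i(i(y,y),i(i(x,y),i(x,y)))) -/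
def D3 : Fm := .i (.i (.var 0) (.var 0))
  (.i (.i (.var 1) (.var 1)) (.i (.i (.var 0) (.var 1)) (.i (.var 0) (.var 1))))

/-- L1 = i(i(x,y),i(i(y,z),i(x,z))) -/
def L1 : Fm := .i (.i (.var 0) (.var 1)) (.i (.i (.var 1) (.var 2)) (.i (.var 0) (.var 2)))
/-- L2 = i(i(n(x),x),x) -/
def L2 : Fm := .i (.i (.n (.var 0)) (.var 0)) (.var 0)
/-- L3 = i(x,i(n(x),y)) -/
def L3 : Fm := .i (.var 0) (.i (.n (.var 0)) (.var 1))
/-- L4 = i(i(x,n(x)),n(x)) -/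
def L4 : Fm := .i (.i (.var 0) (.n (.var 0))) (.n (.var 0))
/-- L5 = i(n(x),i(x,y)) -/
def L5 : Fm := .i (.n (.var 0)) (.i (.var 0) (.var 1))
/-- The Łukasiewicz axiom system for two-valued propositional calculus. -/
def Lax : Set Fm := {L1, L2, L3}

/-- A1 = i(x,i(y,x)) -/
def A1 : Fm := .i (.var 0) (.i (.var 1) (.var 0))
/-- A2 = i(i(x,y),i(i(y,z),i(x,z))) -/
def A2 : Fm := .i (.i (.var 0) (.var 1)) (.i (.i (.var 1) (.var 2)) (.i (.var 0) (.var 2)))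
/-- A3 = i(i(i(x,y),y),i(i(y,x),x)) -/
def A3 : Fm := .i (.i (.i (.var 0) (.var 1)) (.var 1)) (.i (.i (.var 1) (.var 0)) (.var 0))
/-- A4 = i(i(n(x),n(y)),i(y,x)) -/
def A4 : Fm := .i (.i (.n (.var 0)) (.n (.var 1))) (.i (.var 1) (.var 0))
/-- A6 = i(i(x,y),i(n(y),n(x))) -/
def A6 : Fm := .i (.i (.var 0) (.var 1)) (.i (.n (.var 1)) (.n (.var 0)))
/-- A7 = i(i(n(x),y),i(n(y),x)) -/
def A7 : Fm := .i (.i (.n (.var 0)) (.var 1)) (.i (.n (.var 1)) (.var 0))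
/-- A8 = i(i(x,n(y)),i(y,n(x))) -/
def A8 : Fm := .i (.i (.var 0) (.n (.var 1))) (.i (.var 1) (.n (.var 0)))
/-- The axiom system of Łukasiewicz's infinite-valued sentential calculus. -/
def Aax : Set Fm := {A1, A2, A3, A4}

/-- H1 = i(x,i(y,x)) -/
def H1 : Fm := .i (.var 0) (.i (.var 1) (.var 0))
/-- H2 = i(i(x,i(y,z)),i(i(x,y),i(x,z))) -/
def H2 : Fm := .i (.i (.var 0) (.i (.var 1) (.var 2)))
  (.i (.i (.var 0) (.var 1)) (.i (.var 0) (.var 2)))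
/-- H3 = i(i(x,n(x)),n(x)) -/
def H3 : Fm := .i (.i (.var 0) (.n (.var 0))) (.n (.var 0))
/-- H4 = i(x,i(n(x),y)) -/
def H4 : Fm := .i (.var 0) (.i (.n (.var 0)) (.var 1))
/-- The intuitionistic axiom system H. -/
def Hax : Set Fm := {H1, H2, H3, H4}

namespace Fm

lemma subst_congr {σ τ : ℕ → Fm} : ∀ {F : Fm}, (∀ k ∈ F.vars, σ k = τ k) → F.subst σ = F.subst τ
  | var k, h => h k (by simp [vars])
  | i a b, h => by
    simp only [vars, Finset.mem_union] at h
    simp only [subst]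
    rw [subst_congr fun k hk => h k (Or.inl hk), subst_congr fun k hk => h k (Or.inr hk)]
  | n a, h => congrArg n (subst_congr (F := a) h)

lemma subst_var (F : Fm) : F.subst var = F := by
  induction F <;> simp_all [subst]

lemma exists_eq_var_of_subst_eq_var {F : Fm} {ρ : ℕ → Fm} {k : ℕ} (h : F.subst ρ = var k) :
    ∃ m, F = var m ∧ ρ m = var k := by
  cases F <;> simp_all [subst]

end Fm

lemma Equiv.Perm.exists_eqOn_of_injOn {α : Type*} (s : Finset α) {f : α → α}
    (hf : Set.InjOn f s) : ∃ p : Equiv.Perm α, ∀ k ∈ s, p k = f k := by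
  let x : Fin s.card ↪ α := s.equivFin.symm.toEmbedding.trans (Function.Embedding.subtype _)
  let y : Fin s.card ↪ α :=
    s.equivFin.symm.toEmbedding.trans ⟨fun a => f a, hf.injective⟩
  obtain ⟨p, hp⟩ :=
    (Equiv.Perm.isMultiplyPretransitive α s.card).exists_smul_eq x y
  refine ⟨p, fun k hk => ?_⟩
  have hpk := DFunLike.congr_fun hp (s.equivFin ⟨k, hk⟩)
  simp only [x, y, Function.Embedding.smul_apply, Function.Embedding.trans_apply,
    Equiv.coe_toEmbedding, Equiv.symm_apply_apply] at hpk
  exact hpk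

/-- If `A` is a substitution instance of `C` (and `C` shares no variables with
`i(A,B)`), then the result `Bσ` of applying condensed detachment to the major
premiss `i(A,B)` and the minor premiss `C` is `B` or an alphabetic variant of `B`. -/
theorem stmt1 (A B C : Fm) (τ σ : ℕ → Fm)
    (hdisj : Disjoint (Fm.i A B).vars C.vars)
    (hinst : A = C.subst τ)
    (hmgu : IsMGU σ A C) :
    B.subst σ = B ∨ AlphVar B (B.subst σ) := by
  right
  have hA : ∀ k ∈ A.vars, k ∉ C.vars := fun k hk =>
    Finset.disjoint_left.1 hdisj (Finset.mem_union_left _ hk)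
  have hB : ∀ k ∈ B.vars, k ∉ C.vars := fun k hk =>
    Finset.disjoint_left.1 hdisj (Finset.mem_union_right _ hk)
  have hunif : Unifies (fun k => if k ∈ C.vars then τ k else Fm.var k) A C := by
    calc A.subst _ = A.subst Fm.var := Fm.subst_congr fun k hk => if_neg (hA k hk)
      _ = C.subst τ := by rw [Fm.subst_var, hinst]
      _ = C.subst _ := Fm.subst_congr fun k hk => (if_pos hk).symm
  obtain ⟨ρ, hρ⟩ := hmgu.2 _ hunif
  have hvar : ∀ k, k ∈ B.vars → ∃ m, σ k = Fm.var m ∧ ρ m = Fm.var k := fun k hk =>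
    Fm.exists_eq_var_of_subst_eq_var ((hρ k).symm.trans (if_neg (hB k hk)))
  choose! f hσ hf using hvar
  have hinj : Set.InjOn f B.vars := fun a ha b hb hab =>
    Fm.var.inj ((hf a ha).symm.trans ((congrArg ρ hab).trans (hf b hb)))
  obtain ⟨p, hp⟩ := Equiv.Perm.exists_eqOn_of_injOn B.vars hinj
  exact ⟨p, Fm.subst_congr fun k hk => by rw [hσ k hk, renameSubst, hp k hk]⟩
end

section
/- From the Łukasiewicz axioms L1, L2, L3, there exist double-negation-free condensed-detachment proofs of each of the formulas D1, D2, and D3. -/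
namespace Fm

theorem subst_subst (σ τ : ℕ → Fm) (t : Fm) :
    (t.subst σ).subst τ = t.subst fun k => (σ k).subst τ := by
  induction t <;> simp_all [subst]

theorem subst_var_s8 (t : Fm) : t.subst var = t := by
  induction t <;> simp_all [subst]

theorem subst_congr_s8 {σ τ : ℕ → Fm} {t : Fm} (h : ∀ k ∈ t.vars, σ k = τ k) :
    t.subst σ = t.subst τ := by
  induction t <;> simp_all [subst, vars]

/-- The substitution of `t` for the variable `x`. -/
def single (x : ℕ) (t : Fm) : ℕ → Fm := Function.update var x t

theorem subst_single_of_notMem {x : ℕ} {s t : Fm} (h : x ∉ t.vars) :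
    t.subst (single x s) = t := by
  conv_rhs => rw [← subst_var_s8 t]
  refine subst_congr_s8 fun k hk => ?_
  rw [single, Function.update_of_ne (ne_of_mem_of_not_mem hk h)]

theorem subst_comp_single {x : ℕ} {t : Fm} {τ : ℕ → Fm} (h : τ x = t.subst τ) (k : ℕ) :
    (single x t k).subst τ = τ k := by
  by_cases hk : k = x
  · subst hk; simp [single, h]
  · simp [single, hk, subst]

/-- First-order unification of a list of equations, with bounded recursion depth. -/
def unify : ℕ → List (Fm × Fm) → Option (ℕ → Fm)
  | 0, _ => none
  | _ + 1, [] => some var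
  | m + 1, (var x, t) :: E =>
    if t = var x then unify m E
    else if x ∈ t.vars then none
    else (unify m (E.map (Prod.map (subst (single x t)) (subst (single x t))))).map
      fun σ k => (single x t k).subst σ
  | m + 1, (i a b, var x) :: E => unify m ((var x, i a b) :: E)
  | m + 1, (n a, var x) :: E => unify m ((var x, n a) :: E)
  | m + 1, (i a b, i c d) :: E => unify m ((a, c) :: (b, d) :: E)
  | m + 1, (n a, n b) :: E => unify m ((a, b) :: E)
  | _ + 1, (i _ _, n _) :: _ => none
  | _ + 1, (n _, i _ _) :: _ => none

theorem unify_sound {m : ℕ} {E : List (Fm × Fm)} {σ : ℕ → Fm} (h : unify m E = some σ) :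
    (∀ e ∈ E, Unifies σ e.1 e.2) ∧
      ∀ τ : ℕ → Fm, (∀ e ∈ E, Unifies τ e.1 e.2) → ∀ k, τ k = (σ k).subst τ := by
  fun_induction unify m E generalizing σ with
  | case1 => simp at h
  | case2 => cases h; simp [subst]
  | case3 m x E ih => simpa [Unifies] using ih h
  | case4 => simp at h
  | case5 m x t E _ hx ih =>
    obtain ⟨ρ, hρ, rfl⟩ := Option.map_eq_some_iff.1 h
    obtain ⟨hu, hg⟩ := ih hρ
    simp only [List.mem_map, forall_exists_index, and_imp, forall_apply_eq_imp_iff₂, Prod.map_fst,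
      Prod.map_snd, Unifies, subst_subst] at hu hg
    refine ⟨?_, fun τ hτ k => ?_⟩
    · refine List.forall_mem_cons.2 ⟨?_, hu⟩
      rw [Unifies, ← subst_subst, ← subst_subst, subst_single_of_notMem hx]
      simp [subst, single]
    · obtain ⟨hx', hE⟩ := List.forall_mem_cons.1 hτ
      have hs := subst_comp_single (x := x) (t := t) (τ := τ) hx'
      rw [subst_subst, ← funext (hg τ fun e he => ?_), hs]
      simp only [hs]
      exact hE e he
  | case6 m a b x E ih => simpa [Unifies, eq_comm] using ih h
  | case7 m a x E ih => simpa [Unifies, eq_comm] using ih h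
  | case8 m a b c d E ih => simpa [Unifies, subst, and_assoc] using ih h
  | case9 m a b E ih => simpa [Unifies, subst] using ih h
  | case10 => simp at h
  | case11 => simp at h

/-- The occurrences of variables in a formula, from left to right. -/
def varList : Fm → List ℕ
  | var k => [k]
  | i a b => a.varList ++ b.varList
  | n a => a.varList

/-- A permutation of the variables that numbers those of `t` in order of first occurrence. -/
def numbering (t : Fm) : Equiv.Perm ℕ :=
  (t.varList.foldl
    (fun (s : Equiv.Perm ℕ × ℕ) v =>
      if s.1 v < s.2 then s else (Equiv.swap (s.1 v) s.2 * s.1, s.2 + 1)) (1, 0)).1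

/-- Executable test for double-negation freeness. -/
def isDNFree : Fm → Bool
  | var _ => true
  | i a b => a.isDNFree && b.isDNFree
  | n (n _) => false
  | n (var _) => true
  | n (i a b) => a.isDNFree && b.isDNFree

theorem dnFree_of_isDNFree {t : Fm} (h : t.isDNFree) : DNFree t := by
  rintro ⟨s, hs⟩
  fun_induction isDNFree t with
  | case1 => cases hs
  | case2 a b iha ihb =>
    rw [Bool.and_eq_true] at h
    cases hs with
    | il hs => exact iha h.1 hs
    | ir hs => exact ihb h.2 hs
  | case3 => simp at h
  | case4 => cases hs with | neg hs => cases hs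
  | case5 a b iha ihb =>
    rw [Bool.and_eq_true] at h
    cases hs with
    | neg hs =>
      cases hs with
      | il hs => exact iha h.1 hs
      | ir hs => exact ihb h.2 hs

/-- The permutation exchanging the blocks `{0, …, N - 1}` and `{N, …, 2 * N - 1}`. -/
def blockSwap (N : ℕ) : Equiv.Perm ℕ :=
  Function.Involutive.toPerm
    (fun k => if k < N then k + N else if k < 2 * N then k - N else k)
    (fun k => by grind)

/-- Executable condensed detachment, rejecting conclusions that contain a double negation.
The variables of the conclusion are numbered in order of first occurrence. -/
def detach? : Fm → Fm → Option Fm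
  | i A B, q =>
    let C := q.subst (renameSubst (blockSwap 8))
    if Disjoint (i A B).vars C.vars then
      ((unify 100 [(A, C)]).map fun σ =>
        (B.subst σ).subst (renameSubst (B.subst σ).numbering)).filter isDNFree
    else none
  | _, _ => none

theorem detach?_sound {p q c : Fm} (h : detach? p q = some c) : CD p q c ∧ DNFree c := by
  match p, h with
  | i A B, h =>
    simp only [detach?] at h
    split_ifs at h with hd
    obtain ⟨hm, hc⟩ := Option.filter_eq_some_iff.1 h
    obtain ⟨σ, hσ, rfl⟩ := Option.map_eq_some_iff.1 hm
    obtain ⟨hu, hg⟩ := unify_sound hσ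
    simp only [List.mem_singleton, forall_eq] at hu hg
    exact ⟨⟨A, B, _, σ, rfl, ⟨_, rfl⟩, hd, ⟨hu, fun τ hτ => ⟨τ, hg τ hτ⟩⟩, ⟨_, rfl⟩⟩,
      dnFree_of_isDNFree hc⟩

end Fm

theorem AlphVar.refl (t : Fm) : AlphVar t t := ⟨1, (Fm.subst_var_s8 t).symm⟩

/-- Double-negation-free derivability from the Łukasiewicz axioms. -/
abbrev Deriv (t : Fm) : Prop := DNFreeCDProvable Lax t

namespace Deriv

local prefix:max "#" => Fm.var
local prefix:max "∼" => Fm.n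
local infixr:60 " ⇒ " => Fm.i

theorem detach {p q c : Fm} (hp : Deriv p) (hq : Deriv q) (h : p.detach? q = some c) : Deriv c :=
  .cd hp hq (Fm.detach?_sound h).1 (Fm.detach?_sound h).2

theorem deriv_l1 : Deriv L1 := .ax (by simp [Lax]) (.refl _)

theorem deriv_l2 : Deriv L2 := .ax (by simp [Lax]) (.refl _)

theorem deriv_l3 : Deriv L3 := .ax (by simp [Lax]) (.refl _)

/-- Composition of implications: two condensed detachments, the first with major premiss L1. -/
theorem comp {p q c : Fm} (hp : Deriv p) (hq : Deriv q)
    (h : (L1.detach? p).bind (·.detach? q) = some c) : Deriv c := by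
  obtain ⟨r, hr, hc⟩ := Option.bind_eq_some_iff.1 h
  exact (deriv_l1.detach hp hr).detach hq hc

theorem antecedent_of_neg_imp : Deriv (((∼#0 ⇒ #1) ⇒ #2) ⇒ #0 ⇒ #2) :=
  .detach deriv_l1 deriv_l3 (by decide +kernel)

/-- The formula D1. -/
theorem identity : Deriv (#0 ⇒ #0) :=
  .detach antecedent_of_neg_imp deriv_l2 (by decide +kernel)

theorem comp_suffix : Deriv ((((#0 ⇒ #1) ⇒ #2 ⇒ #1) ⇒ #3) ⇒ (#2 ⇒ #0) ⇒ #3) :=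
  .detach deriv_l1 deriv_l1 (by decide +kernel)

theorem const_identity : Deriv (#0 ⇒ #1 ⇒ #1) := by
  have h1 : Deriv (∼(#0 ⇒ #0) ⇒ #1) := .detach deriv_l3 identity (by decide +kernel)
  have h2 : Deriv ((#0 ⇒ #1) ⇒ ∼(#2 ⇒ #2) ⇒ #1) := .detach deriv_l1 h1 (by decide +kernel)
  have h3 : Deriv (#0 ⇒ ∼(#1 ⇒ #1) ⇒ #2) := .detach antecedent_of_neg_imp h2 (by decide +kernel)
  exact .comp h3 deriv_l2 (by decide +kernel)

/-- A weakened internal form of the Clavius law L2. -/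
theorem const_clavius : Deriv ((#0 ⇒ ∼#1 ⇒ #1) ⇒ #2 ⇒ #0 ⇒ #1) := by
  have h1 : Deriv ((#0 ⇒ #1) ⇒ (∼#0 ⇒ #0) ⇒ #1) := .detach deriv_l1 deriv_l2 (by decide +kernel)
  have h2 : Deriv (#0 ⇒ (∼#1 ⇒ #1) ⇒ #1) := .comp const_identity h1 (by decide +kernel)
  have h3 : Deriv ((((∼#0 ⇒ #0) ⇒ #0) ⇒ #1) ⇒ #2 ⇒ #1) := .detach deriv_l1 h2 (by decide +kernel)
  exact .detach comp_suffix h3 (by decide +kernel)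

theorem const_neg_imp : Deriv (#0 ⇒ #1 ⇒ ∼#0 ⇒ #2) := by
  have h1 : Deriv (#0 ⇒ (#1 ⇒ #2) ⇒ ∼#0 ⇒ #2) :=
    .detach antecedent_of_neg_imp deriv_l1 (by decide +kernel)
  exact .comp h1 antecedent_of_neg_imp (by decide +kernel)

theorem weakening : Deriv (#0 ⇒ #1 ⇒ #0) := by
  have h1 : Deriv (#0 ⇒ #1 ⇒ #2 ⇒ #0) := .comp const_neg_imp const_clavius (by decide +kernel)
  have h2 : Deriv (#0 ⇒ #1 ⇒ #2 ⇒ #1) := .detach const_clavius h1 (by decide +kernel)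
  exact .detach h2 deriv_l2 (by decide +kernel)

theorem clavius_imp : Deriv ((((∼#0 ⇒ #0) ⇒ #0) ⇒ #1) ⇒ #1) := by
  have h1 : Deriv (#0 ⇒ (∼#1 ⇒ #1) ⇒ #1) := .detach weakening deriv_l2 (by decide +kernel)
  have h2 : Deriv ((((∼#0 ⇒ #0) ⇒ #0) ⇒ #1) ⇒ #2 ⇒ #1) := .detach deriv_l1 h1 (by decide +kernel)
  have h3 : Deriv (#0 ⇒ (((∼#1 ⇒ #1) ⇒ #1) ⇒ #2) ⇒ #2) :=
    .detach const_clavius h2 (by decide +kernel)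
  exact .detach h3 identity (by decide +kernel)

theorem clavius_under : Deriv ((#0 ⇒ ∼#1 ⇒ #1) ⇒ #0 ⇒ #1) :=
  .comp deriv_l1 clavius_imp (by decide +kernel)

theorem comp_under : Deriv ((#0 ⇒ #1 ⇒ #2) ⇒ (#3 ⇒ #1) ⇒ #0 ⇒ #3 ⇒ #2) :=
  .detach comp_suffix comp_suffix (by decide +kernel)

theorem assertion : Deriv (#0 ⇒ (#0 ⇒ #1) ⇒ #1) := by
  have h1 : Deriv (#0 ⇒ (#0 ⇒ #1) ⇒ #2 ⇒ #1) := .comp weakening deriv_l1 (by decide +kernel)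
  exact .comp h1 clavius_under (by decide +kernel)

theorem commutation : Deriv ((#0 ⇒ #1 ⇒ #2) ⇒ #1 ⇒ #0 ⇒ #2) :=
  .detach comp_under assertion (by decide +kernel)

/-- The formula L5. -/
theorem neg_imp_imp : Deriv (∼#0 ⇒ #0 ⇒ #1) :=
  .detach commutation deriv_l3 (by decide +kernel)

theorem by_cases : Deriv ((∼#0 ⇒ #1) ⇒ (#1 ⇒ #0) ⇒ #0) :=
  .comp deriv_l1 clavius_under (by decide +kernel)

theorem imp_by_cases : Deriv (((#0 ⇒ #1) ⇒ #2) ⇒ (#2 ⇒ #0) ⇒ #0) := by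
  have h1 : Deriv (((#0 ⇒ #1) ⇒ #2) ⇒ ∼#0 ⇒ #2) := .detach deriv_l1 neg_imp_imp (by decide +kernel)
  exact .comp h1 by_cases (by decide +kernel)

/-- The formula L4, obtained without instantiating a double negation. -/
theorem imp_neg_self : Deriv ((#0 ⇒ ∼#0) ⇒ ∼#0) :=
  .detach imp_by_cases deriv_l2 (by decide +kernel)

theorem peirce : Deriv (((#0 ⇒ #1) ⇒ #0) ⇒ #0) :=
  .detach imp_by_cases identity (by decide +kernel)

theorem contraction : Deriv ((#0 ⇒ #0 ⇒ #1) ⇒ #0 ⇒ #1) :=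
  .comp deriv_l1 peirce (by decide +kernel)

theorem prefixing : Deriv ((#0 ⇒ #1) ⇒ (#2 ⇒ #0) ⇒ #2 ⇒ #1) :=
  .detach commutation deriv_l1 (by decide +kernel)

theorem contraposition : Deriv ((#0 ⇒ #1) ⇒ ∼#1 ⇒ ∼#0) := by
  have h1 : Deriv ((#0 ⇒ #1 ⇒ ∼#1) ⇒ #0 ⇒ ∼#1) := .detach prefixing imp_neg_self (by decide +kernel)
  have h2 : Deriv ((#0 ⇒ #1) ⇒ (#1 ⇒ ∼#0) ⇒ ∼#0) := .comp deriv_l1 h1 (by decide +kernel)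
  have h3 : Deriv ((#0 ⇒ ∼#1) ⇒ (#1 ⇒ #0) ⇒ ∼#1) := .detach commutation h2 (by decide +kernel)
  have h4 : Deriv (∼#0 ⇒ (#1 ⇒ #0) ⇒ ∼#1) := .comp neg_imp_imp h3 (by decide +kernel)
  exact .detach commutation h4 (by decide +kernel)

/-- Contraction applied to L1 identifies the three variables of L1. -/
theorem identity_self : Deriv ((#0 ⇒ #0) ⇒ #0 ⇒ #0) :=
  .detach contraction deriv_l1 (by decide +kernel)

/-- The formula D2. -/
theorem d2 : Deriv ((#0 ⇒ #0) ⇒ ∼#0 ⇒ ∼#0) :=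
  .comp identity_self contraposition (by decide +kernel)

theorem imp_congr : Deriv ((#0 ⇒ #1) ⇒ (#2 ⇒ #3) ⇒ (#3 ⇒ #0) ⇒ #2 ⇒ #1) := by
  have h1 : Deriv ((#0 ⇒ #1) ⇒ (#2 ⇒ #3 ⇒ #0) ⇒ #2 ⇒ #3 ⇒ #1) :=
    .comp prefixing prefixing (by decide +kernel)
  have h2 : Deriv ((#0 ⇒ #1) ⇒ (#2 ⇒ #3 ⇒ #4 ⇒ #0) ⇒ #2 ⇒ #3 ⇒ #4 ⇒ #1) :=
    .comp h1 prefixing (by decide +kernel)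
  have h3 : Deriv ((#0 ⇒ #1 ⇒ #2 ⇒ #3) ⇒ (#3 ⇒ #4) ⇒ #0 ⇒ #1 ⇒ #2 ⇒ #4) :=
    .detach commutation h2 (by decide +kernel)
  exact .detach h3 deriv_l1 (by decide +kernel)

/-- The formula D3. -/
theorem d3 : Deriv ((#0 ⇒ #0) ⇒ (#1 ⇒ #1) ⇒ (#0 ⇒ #1) ⇒ #0 ⇒ #1) := by
  have h1 : Deriv ((#0 ⇒ #0) ⇒ (#1 ⇒ #2) ⇒ (#2 ⇒ #0) ⇒ #1 ⇒ #0) :=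
    .comp identity_self imp_congr (by decide +kernel)
  have h2 : Deriv ((#0 ⇒ #1) ⇒ (#2 ⇒ #2) ⇒ (#1 ⇒ #2) ⇒ #0 ⇒ #2) :=
    .detach commutation h1 (by decide +kernel)
  exact .comp identity_self h2 (by decide +kernel)

end Deriv

/-- From the Łukasiewicz axioms L1, L2, L3 there exist double-negation-free
condensed-detachment proofs of D1, D2, and D3. -/
theorem stmt8 :
    DNFreeCDProvable Lax D1 ∧ DNFreeCDProvable Lax D2 ∧ DNFreeCDProvable Lax D3 :=
  ⟨Deriv.identity, Deriv.d2, Deriv.d3⟩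
end
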